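/- Let G be a 3-γₜ-edge-critical graph on n vertices with minimum degree at least 3 that contains an independent vertex cut of cardinality at least three. Then the complement of G has strictly fewer than ⌊n²/4⌋ edges. -/

import Mathlib

/-- The total domination number of a graph, as an extended natural number
(`⊤` when no total dominating set exists). -/
noncomputable def gammaT {V : Type*} (G : SimpleGraph V) : ℕ∞ :=
  sInf {n : ℕ∞ | ∃ S : Finset V, (S.card : ℕ∞) = n ∧ ∀ v : V, ∃ u ∈ S, G.Adj v u}

/-- G has diameter two. -/
def DiamTwo {V : Type*} (G : SimpleGraph V) : Prop :=
  (∀ u v : V, u ≠ v → G.Adj u v ∨ ∃ w : V, G.Adj u w ∧ G.Adj w v) ∧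
    ∃ u v : V, u ≠ v ∧ ¬ G.Adj u v

/-- Removing the vertex set S disconnects G. -/
def RemovalDisconnects {V : Type*} (G : SimpleGraph V) (S : Set V) : Prop :=
  ∃ a b : (Sᶜ : Set V), ¬ (G.induce Sᶜ).Reachable a b

/-- G is 3-γₜ-edge-critical. -/
def Critical3 {V : Type*} [DecidableEq V] (G : SimpleGraph V) : Prop :=
  gammaT G = 3 ∧
    ∀ u v : V, u ≠ v → ¬ G.Adj u v →
      gammaT (G ⊔ SimpleGraph.fromEdgeSet {s(u, v)}) = 2

namespace SimpleGraph

variable {V : Type*} {G : SimpleGraph V}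

/-- `u` and `x` are adjacent and together totally dominate exactly the vertices other than `v`. -/
def QuasiDominates (G : SimpleGraph V) (u x v : V) : Prop :=
  G.Adj u x ∧ ∀ w, (G.Adj w u ∨ G.Adj w x) ↔ w ≠ v

/-- The combinatorial content of being 3-γₜ-edge-critical. -/
structure PairCritical (G : SimpleGraph V) : Prop where
  undominated : ∀ p q, ∃ w, ¬ G.Adj w p ∧ ¬ G.Adj w q
  pair : ∀ u v, u ≠ v → ¬ G.Adj u v →
    (∀ w, w ≠ u → w ≠ v → G.Adj w u ∨ G.Adj w v) ∨
      ∃ x, G.QuasiDominates u x v ∨ G.QuasiDominates v x u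

/-- `S` is an independent set separating the nonempty sets `A` and `B`, which together with `S`
partition the vertex set. -/
structure IndepSeparation (G : SimpleGraph V) (A B S : Set V) : Prop where
  cover : ∀ v, v ∈ A ∨ v ∈ B ∨ v ∈ S
  disjoint_left : ∀ v ∈ A, v ∉ S
  disjoint_right : ∀ v ∈ B, v ∉ S
  disjoint : ∀ v ∈ A, v ∉ B
  not_adj : ∀ a ∈ A, ∀ b ∈ B, ¬ G.Adj a b
  indep : ∀ a ∈ S, ∀ b ∈ S, ¬ G.Adj a b
  nonempty_left : A.Nonempty
  nonempty_right : B.Nonempty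

theorem IndepSeparation.symm {A B S : Set V} (h : G.IndepSeparation A B S) :
    G.IndepSeparation B A S where
  cover v := by rcases h.cover v with h | h | h <;> simp [h]
  disjoint_left := h.disjoint_right
  disjoint_right := h.disjoint_left
  disjoint v hB hA := h.disjoint v hA hB
  not_adj b hb a ha hab := h.not_adj a ha b hb hab.symm
  indep := h.indep
  nonempty_left := h.nonempty_right
  nonempty_right := h.nonempty_left

theorem exists_indepSeparation {S : Set V} (hind : ∀ a ∈ S, ∀ b ∈ S, ¬ G.Adj a b)
    (hcut : RemovalDisconnects G S) : ∃ A B, G.IndepSeparation A B S := by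
  obtain ⟨a, b, hab⟩ := hcut
  refine ⟨{v | ∃ h : v ∈ Sᶜ, (G.induce Sᶜ).Reachable a ⟨v, h⟩},
    {v | ∃ h : v ∈ Sᶜ, ¬ (G.induce Sᶜ).Reachable a ⟨v, h⟩}, ?_, ?_, ?_, ?_, ?_, hind, ?_, ?_⟩
  · intro v
    by_cases hv : v ∈ S
    · exact .inr (.inr hv)
    · by_cases hr : (G.induce Sᶜ).Reachable a ⟨v, hv⟩
      · exact .inl ⟨hv, hr⟩
      · exact .inr (.inl ⟨hv, hr⟩)
  · rintro v ⟨h, -⟩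
    exact h
  · rintro v ⟨h, -⟩
    exact h
  · rintro v ⟨_, h⟩ ⟨_, h'⟩
    exact h' h
  · rintro v ⟨hv, h⟩ w ⟨hw, h'⟩ hvw
    refine h' (h.trans (Adj.reachable ?_))
    simpa using hvw
  · exact ⟨a, a.2, .rfl⟩
  · exact ⟨b, b.2, hab⟩

/-- The missing edge `e` is either the pair `{p, q}` itself or is recovered from the edge `pq`
through the unique vertex that `p` and `q` fail to dominate. -/
def Charges (G : SimpleGraph V) (P : Set V) (e : Sym2 V) (p q : V) : Prop :=
  (¬ G.Adj p q ∧ e = s(p, q)) ∨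
    ∃ w, G.QuasiDominates p q w ∧ ((w ∈ P ∧ e = s(p, w)) ∨ (w ∉ P ∧ e = s(q, w)))

theorem Charges.unique {P : Set V} {e e' : Sym2 V} {p q : V} (h : G.Charges P e p q)
    (h' : G.Charges P e' p q) : e = e' := by
  rcases h with ⟨h, rfl⟩ | ⟨w, h, hw⟩ <;> rcases h' with ⟨h', rfl⟩ | ⟨w', h', hw'⟩
  · rfl
  · exact absurd h'.1 h
  · exact absurd h.1 h'
  · obtain rfl : w = w' := by
      by_contra hne
      have h1 := (h'.2 w).2 hne
      exact (h.2 w).1 h1 rfl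
    rcases hw with ⟨hw, rfl⟩ | ⟨hw, rfl⟩ <;> rcases hw' with ⟨hw', rfl⟩ | ⟨hw', rfl⟩ <;>
      first | rfl | contradiction

theorem QuasiDominates.symm {p q w : V} (h : G.QuasiDominates p q w) :
    G.QuasiDominates q p w :=
  ⟨h.1.symm, fun t => by rw [or_comm, h.2]⟩

theorem card_compl_edgeSet_lt [Fintype V] (P : Set V)
    (hpair : ∀ u w, u ≠ w → ¬ G.Adj u w → (u ∈ P ↔ w ∈ P) →
      ∃ x, (x ∈ P ↔ u ∉ P) ∧ (G.QuasiDominates u x w ∨ G.QuasiDominates w x u))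
    (hmiss : ∀ f : Gᶜ.edgeSet → V × V, (∀ e : Gᶜ.edgeSet, G.Charges P e (f e).1 (f e).2) →
      ∃ p ∈ P, ∃ q ∉ P, ∀ e : Gᶜ.edgeSet, f e ≠ (p, q)) :
    Gᶜ.edgeSet.ncard < Fintype.card V ^ 2 / 4 := by
  classical
  have hex : ∀ e : Gᶜ.edgeSet, ∃ r : V × V, (r.1 ∈ P ∧ r.2 ∉ P) ∧ G.Charges P e r.1 r.2 := by
    rintro ⟨e, he⟩
    induction e using Sym2.ind with | _ u w =>
    obtain ⟨hne, hadj⟩ : u ≠ w ∧ ¬ G.Adj u w := by simpa using he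
    have key : ∀ u w x, (u ∈ P ↔ w ∈ P) → (x ∈ P ↔ u ∉ P) → G.QuasiDominates u x w →
        ∃ r : V × V, (r.1 ∈ P ∧ r.2 ∉ P) ∧ G.Charges P s(u, w) r.1 r.2 := by
      intro u w x huw hx hq
      by_cases hu : u ∈ P
      · exact ⟨(u, x), ⟨hu, by simpa [hx] using hu⟩, .inr ⟨w, hq, .inl ⟨huw.1 hu, rfl⟩⟩⟩
      · exact ⟨(x, u), ⟨hx.2 hu, hu⟩, .inr ⟨w, hq.symm, .inr ⟨by rwa [← huw], rfl⟩⟩⟩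
    by_cases huw : u ∈ P ↔ w ∈ P
    · obtain ⟨x, hx, hq | hq⟩ := hpair u w hne hadj huw
      · exact key u w x huw hx hq
      · simpa only [Sym2.eq_swap] using key w u x huw.symm (by rw [hx, huw]) hq
    · by_cases hu : u ∈ P
      · exact ⟨(u, w), ⟨hu, fun hw => huw ⟨fun _ => hw, fun _ => hu⟩⟩, .inl ⟨hadj, rfl⟩⟩
      · refine ⟨(w, u), ⟨?_, hu⟩, .inl ⟨fun h => hadj h.symm, Sym2.eq_swap⟩⟩
        by_contra hw
        exact huw ⟨fun h => absurd h hu, fun h => absurd h hw⟩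
  choose f hf hc using hex
  obtain ⟨p, hp, q, hq, hpq⟩ := hmiss f hc
  have hinj : Function.Injective f := by
    intro e e' h
    have h1 := hc e
    rw [h] at h1
    exact Subtype.ext (h1.unique (hc e'))
  have hlt : (Finset.univ.image f).card < (P.toFinset ×ˢ P.toFinsetᶜ).card := by
    apply Finset.card_lt_card
    rw [Finset.ssubset_iff_of_subset]
    · exact ⟨(p, q), by simp [hp, hq], by simpa using fun e he => hpq ⟨e, he⟩⟩
    · intro r hr
      obtain ⟨e, -, rfl⟩ := Finset.mem_image.1 hr
      simpa using hf e
  rw [Finset.card_image_of_injective _ hinj, Finset.card_univ, ← Nat.card_eq_fintype_card,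
    Nat.card_coe_set_eq, Finset.card_product] at hlt
  refine hlt.trans_le ?_
  rw [Nat.le_div_iff_mul_le (by norm_num), ← Finset.card_add_card_compl P.toFinset]
  linarith [four_mul_le_sq_add P.toFinset.card P.toFinsetᶜ.card]

namespace IndepSeparation

variable {A B S : Set V}

/-- For two vertices of the separator, one of them together with a vertex outside the separator
dominates all but the other. -/
theorem exists_quasiDominates (h : G.IndepSeparation A B S) (hG : G.PairCritical) {u v t : V}
    (hu : u ∈ S) (hv : v ∈ S) (ht : t ∈ S) (huv : u ≠ v) (htu : t ≠ u) (htv : t ≠ v) :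
    ∃ x, G.QuasiDominates u x v ∨ G.QuasiDominates v x u := by
  rcases hG.pair u v huv (h.indep u hu v hv) with h1 | h1
  · rcases h1 t htu htv with h2 | h2
    · exact absurd h2 (h.indep t ht u hu)
    · exact absurd h2 (h.indep t ht v hv)
  · exact h1

theorem left_or_right_of_quasiDominates (h : G.IndepSeparation A B S) {u x v : V}
    (hu : u ∈ S) (hq : G.QuasiDominates u x v) : x ∈ A ∨ x ∈ B := by
  rcases h.cover x with hx | hx | hx
  · exact .inl hx
  · exact .inr hx
  · exact absurd hq.1 (h.indep u hu x hx)

theorem left_full_of_quasiDominates (h : G.IndepSeparation A B S) {u x v : V}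
    (hv : v ∈ S) (hq : G.QuasiDominates u x v) (hx : x ∈ B) : ∀ a ∈ A, G.Adj u a := by
  intro a ha
  rcases (hq.2 a).2 (by rintro rfl; exact h.disjoint_left a ha hv) with h1 | h1
  · exact h1.symm
  · exact absurd h1 (h.not_adj a ha x hx)

theorem right_full_of_quasiDominates (h : G.IndepSeparation A B S) {u x v : V}
    (hv : v ∈ S) (hq : G.QuasiDominates u x v) (hx : x ∈ A) : ∀ b ∈ B, G.Adj u b :=
  h.symm.left_full_of_quasiDominates hv hq hx

theorem adj_of_quasiDominates (h : G.IndepSeparation A B S) {u x v w : V}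
    (hu : u ∈ S) (hw : w ∈ S) (hq : G.QuasiDominates u x v) (hwv : w ≠ v) : G.Adj w x :=
  ((hq.2 w).2 hwv).resolve_left (h.indep w hw u hu)

theorem _root_.SimpleGraph.QuasiDominates.not_adj {u x v : V} (hq : G.QuasiDominates u x v) :
    ¬ G.Adj v u ∧ ¬ G.Adj v x := by
  simpa using (hq.2 v).not

/-- It cannot happen that one separator vertex is complete to `A` only while another is complete
to `B` only. -/
theorem not_full_on_different_sides (h : G.IndepSeparation A B S) (hG : G.PairCritical)
    {u v t : V} (hu : u ∈ S) (hv : v ∈ S) (ht : t ∈ S) (huv : u ≠ v) (htu : t ≠ u) (htv : t ≠ v)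
    (huA : ∀ a ∈ A, G.Adj u a) (huB : ¬ ∀ b ∈ B, G.Adj u b)
    (hvB : ∀ b ∈ B, G.Adj v b) (hvA : ¬ ∀ a ∈ A, G.Adj v a) : False := by
  obtain ⟨x, hq | hq⟩ := h.exists_quasiDominates hG hu hv ht huv htu htv
  · rcases h.left_or_right_of_quasiDominates hu hq with hx | hx
    · exact huB (h.right_full_of_quasiDominates hv hq hx)
    · exact hq.not_adj.2 (hvB x hx)
  · rcases h.left_or_right_of_quasiDominates hv hq with hx | hx
    · exact hq.not_adj.2 (huA x hx)
    · exact hvA (h.left_full_of_quasiDominates hu hq hx)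

/-- If two vertices of a part fail to be adjacent, one of them together with a separator vertex
complete to the other part dominates all but the other. -/
theorem exists_of_not_adj_left (h : G.IndepSeparation A B S) (hG : G.PairCritical) {u v : V}
    (hu : u ∈ A) (hv : v ∈ A) (huv : u ≠ v) (hadj : ¬ G.Adj u v) :
    ∃ x ∈ S, (∀ b ∈ B, G.Adj x b) ∧ (G.QuasiDominates u x v ∨ G.QuasiDominates v x u) := by
  have key : ∀ u ∈ A, ∀ v ∈ A, ∀ x, G.QuasiDominates u x v → x ∈ S ∧ ∀ b ∈ B, G.Adj x b := by
    intro u hu v hv x hq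
    have hfull : ∀ b ∈ B, G.Adj x b := by
      intro b hb
      rcases (hq.2 b).2 (by rintro rfl; exact h.disjoint b hv hb) with h1 | h1
      · exact absurd h1.symm (h.not_adj u hu b hb)
      · exact h1.symm
    obtain ⟨b, hb⟩ := h.nonempty_right
    rcases h.cover x with hx | hx | hx
    · exact absurd (hfull b hb) (h.not_adj x hx b hb)
    · exact absurd hq.1 (h.not_adj u hu x hx)
    · exact ⟨hx, hfull⟩
  rcases hG.pair u v huv hadj with h1 | ⟨x, hq | hq⟩
  · obtain ⟨b, hb⟩ := h.nonempty_right
    rcases h1 b (by rintro rfl; exact h.disjoint b hu hb)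
      (by rintro rfl; exact h.disjoint b hv hb) with h2 | h2
    · exact absurd h2.symm (h.not_adj u hu b hb)
    · exact absurd h2.symm (h.not_adj v hv b hb)
  · exact ⟨x, (key u hu v hv x hq).1, (key u hu v hv x hq).2, .inl hq⟩
  · exact ⟨x, (key v hv u hu x hq).1, (key v hv u hu x hq).2, .inr hq⟩

/-- If a vertex `a` of `A` fails to be adjacent to a separator vertex `z` that is not complete to
`B`, the pair is quasi-dominated through a vertex of `B` or a separator vertex complete to `B`. -/
theorem exists_of_not_adj_separator (h : G.IndepSeparation A B S) (hG : G.PairCritical) {a z : V}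
    (ha : a ∈ A) (hz : z ∈ S) (hadj : ¬ G.Adj a z) (hzB : ¬ ∀ b ∈ B, G.Adj z b) :
    ∃ x, (x ∈ B ∨ x ∈ S ∧ ∀ b ∈ B, G.Adj x b) ∧
      (G.QuasiDominates a x z ∨ G.QuasiDominates z x a) := by
  have hne : a ≠ z := by rintro rfl; exact h.disjoint_left a ha hz
  rcases hG.pair a z hne hadj with h1 | ⟨x, hq | hq⟩
  · refine absurd (fun b hb => ?_) hzB
    rcases h1 b (by rintro rfl; exact h.disjoint b ha hb)
      (by rintro rfl; exact h.disjoint_right b hb hz) with h2 | h2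
    · exact absurd h2.symm (h.not_adj a ha b hb)
    · exact h2.symm
  · have hfull : ∀ b ∈ B, G.Adj x b := by
      intro b hb
      rcases (hq.2 b).2 (by rintro rfl; exact h.disjoint_right b hb hz) with h1 | h1
      · exact absurd h1.symm (h.not_adj a ha b hb)
      · exact h1.symm
    refine ⟨x, ?_, .inl hq⟩
    rcases h.cover x with hx | hx | hx
    · obtain ⟨b, hb⟩ := h.nonempty_right
      exact absurd (hfull b hb) (h.not_adj x hx b hb)
    · exact .inl hx
    · exact .inr ⟨hx, hfull⟩
  · refine ⟨x, .inl ?_, .inr hq⟩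
    rcases h.left_or_right_of_quasiDominates hz hq with hx | hx
    · refine absurd (fun b hb => ?_) hzB
      rcases (hq.2 b).2 (by rintro rfl; exact h.disjoint b ha hb) with h2 | h2
      · exact h2.symm
      · exact absurd h2.symm (h.not_adj x hx b hb)
    · exact hx

/-- The side of the partition made of `A` and the separator vertices not complete to `B`. -/
def side (G : SimpleGraph V) (A B S : Set V) : Set V :=
  {v | v ∈ A ∨ v ∈ S ∧ ¬ ∀ b ∈ B, G.Adj v b}

theorem exists_other_side (h : G.IndepSeparation A B S) (hG : G.PairCritical)
    (hthird : ∀ u v, ∃ t ∈ S, t ≠ u ∧ t ≠ v)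
    (hno : ∀ s ∈ S, (∀ b ∈ B, G.Adj s b) → ∀ a ∈ A, G.Adj s a) {u w : V} (hne : u ≠ w)
    (hadj : ¬ G.Adj u w) (hside : u ∈ side G A B S ↔ w ∈ side G A B S) :
    ∃ x, (x ∈ side G A B S ↔ u ∉ side G A B S) ∧
      (G.QuasiDominates u x w ∨ G.QuasiDominates w x u) := by
  have hB : ∀ x ∈ B, x ∉ side G A B S := by
    rintro x hx (h1 | h1)
    · exact h.disjoint x h1 hx
    · exact h.disjoint_right x hx h1.1
  have hY : ∀ x ∈ S, (∀ b ∈ B, G.Adj x b) → x ∉ side G A B S := by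
    rintro x hx hf (h1 | h1)
    · exact h.disjoint_left x h1 hx
    · exact h1.2 hf
  by_cases hu : u ∈ side G A B S
  · have hw := hside.1 hu
    suffices ∃ x, x ∉ side G A B S ∧ (G.QuasiDominates u x w ∨ G.QuasiDominates w x u) by
      obtain ⟨x, hx, hq⟩ := this
      exact ⟨x, by simp [hx, hu], hq⟩
    rcases hu with hu | ⟨hu, huB⟩ <;> rcases hw with hw | ⟨hw, hwB⟩
    · obtain ⟨x, hx, hf, hq⟩ := h.exists_of_not_adj_left hG hu hw hne hadj
      exact ⟨x, hY x hx hf, hq⟩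
    · obtain ⟨x, hx | hx, hq⟩ := h.exists_of_not_adj_separator hG hu hw hadj hwB
      · exact ⟨x, hB x hx, hq⟩
      · exact ⟨x, hY x hx.1 hx.2, hq⟩
    · obtain ⟨x, hx | hx, hq⟩ :=
        h.exists_of_not_adj_separator hG hw hu (fun h' => hadj h'.symm) huB
      · exact ⟨x, hB x hx, hq.symm⟩
      · exact ⟨x, hY x hx.1 hx.2, hq.symm⟩
    · obtain ⟨t, ht, htu, htw⟩ := hthird u w
      obtain ⟨x, hq⟩ := h.exists_quasiDominates hG hu hw ht hne htu htw
      refine ⟨x, hB x ?_, hq⟩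
      rcases hq with hq | hq
      · exact (h.left_or_right_of_quasiDominates hu hq).resolve_left
          fun hx => huB (h.right_full_of_quasiDominates hw hq hx)
      · exact (h.left_or_right_of_quasiDominates hw hq).resolve_left
          fun hx => hwB (h.right_full_of_quasiDominates hu hq hx)
  · have hw : w ∉ side G A B S := fun h' => hu (hside.2 h')
    have hcases : ∀ v, v ∉ side G A B S → v ∈ B ∨ v ∈ S ∧ ∀ b ∈ B, G.Adj v b := by
      intro v hv
      rcases h.cover v with h1 | h1 | h1
      · exact absurd (.inl h1) hv
      · exact .inl h1
      · exact .inr ⟨h1, by by_contra h2; exact hv (.inr ⟨h1, h2⟩)⟩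
    rcases hcases u hu with hu' | ⟨hu', huB⟩ <;> rcases hcases w hw with hw' | ⟨hw', hwB⟩
    · obtain ⟨x, hx, hf, hq⟩ := h.symm.exists_of_not_adj_left hG hu' hw' hne hadj
      refine ⟨x, iff_of_true (.inr ⟨hx, fun hf' => ?_⟩) hu, hq⟩
      rcases hq with hq | hq
      · exact hq.not_adj.2 (hf' w hw').symm
      · exact hq.not_adj.2 (hf' u hu').symm
    · exact absurd (hwB u hu').symm hadj
    · exact absurd (huB w hw') hadj
    · obtain ⟨t, ht, htu, htw⟩ := hthird u w
      obtain ⟨x, hq | hq⟩ := h.exists_quasiDominates hG hu' hw' ht hne htu htw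
      · rcases h.left_or_right_of_quasiDominates hu' hq with hx | hx
        · exact absurd (hno w hw' hwB x hx) hq.not_adj.2
        · exact absurd (hwB x hx) hq.not_adj.2
      · rcases h.left_or_right_of_quasiDominates hw' hq with hx | hx
        · exact absurd (hno u hu' huB x hx) hq.not_adj.2
        · exact absurd (huB x hx) hq.not_adj.2

theorem exists_uncharged (h : G.IndepSeparation A B S) (hG : G.PairCritical)
    (hthird : ∀ u v, ∃ t ∈ S, t ≠ u ∧ t ≠ v)
    (hno : ∀ s ∈ S, (∀ b ∈ B, G.Adj s b) → ∀ a ∈ A, G.Adj s a)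
    (f : Gᶜ.edgeSet → V × V) (hf : ∀ e : Gᶜ.edgeSet, G.Charges (side G A B S) e (f e).1 (f e).2) :
    ∃ p ∈ side G A B S, ∃ q ∉ side G A B S, ∀ e : Gᶜ.edgeSet, f e ≠ (p, q) := by
  have hB : ∀ x ∈ B, x ∉ side G A B S := by
    rintro x hx (h1 | h1)
    · exact h.disjoint x h1 hx
    · exact h.disjoint_right x hx h1.1
  have harc : ∀ u ∈ S, ∀ v ∈ S, u ≠ v → ∃ x, ∃ y ∈ S, ∃ y' ∈ S,
      (y = u ∨ y = v) ∧ G.QuasiDominates y' x y := by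
    intro u hu v hv huv
    obtain ⟨t, ht, htu, htv⟩ := hthird u v
    obtain ⟨x, hq | hq⟩ := h.exists_quasiDominates hG hu hv ht huv htu htv
    · exact ⟨x, v, hv, u, hu, .inr rfl, hq⟩
    · exact ⟨x, u, hu, v, hv, .inl rfl, hq⟩
  have hnoCharge : ∀ p q, G.Adj p q → (∀ w, ¬ G.QuasiDominates p q w) → ∀ e, f e ≠ (p, q) := by
    intro p q hpq hw e he
    have h1 := hf e
    rw [he] at h1
    rcases h1 with h1 | ⟨w, h1, -⟩
    · exact h1.1 hpq
    · exact hw w h1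
  by_cases hZ : ∃ z ∈ S, ¬ ∀ a ∈ A, G.Adj z a
  · obtain ⟨z, hz, hzA⟩ := hZ
    have hzP : z ∈ side G A B S := .inr ⟨hz, fun hzB => hzA (hno z hz hzB)⟩
    obtain ⟨s, hs, hsz, -⟩ := hthird z z
    obtain ⟨t, ht, htz, hts⟩ := hthird z s
    obtain ⟨x, v, hv, u, hu, hvst, hq⟩ := harc s hs t ht hts.symm
    have hvz : v ≠ z := by rcases hvst with rfl | rfl <;> assumption
    have hzx : G.Adj z x := h.adj_of_quasiDominates hu hz hq hvz.symm
    obtain ⟨r, hr, hrz, hrv⟩ := hthird z v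
    have hvA : ∀ a ∈ A, G.Adj v a := by
      obtain ⟨y, hq' | hq'⟩ := h.exists_quasiDominates hG hz hv hr hvz.symm hrz hrv
      · rcases h.left_or_right_of_quasiDominates hz hq' with hy | hy
        · exact absurd (hno z hz (h.right_full_of_quasiDominates hv hq' hy)) hzA
        · exact absurd (h.left_full_of_quasiDominates hv hq' hy) hzA
      · rcases h.left_or_right_of_quasiDominates hv hq' with hy | hy
        · exact hno v hv (h.right_full_of_quasiDominates hz hq' hy)
        · exact h.left_full_of_quasiDominates hz hq' hy
    have hxB : x ∈ B := (h.left_or_right_of_quasiDominates hu hq).resolve_left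
      fun hx => hq.not_adj.2 (hvA x hx)
    refine ⟨z, hzP, x, hB x hxB, hnoCharge z x hzx fun w hw => hzA fun a ha => ?_⟩
    have hvw : v = w := by
      by_contra hne
      rcases (hw.2 v).2 hne with h1 | h1
      · exact h.indep v hv z hz h1
      · exact hq.not_adj.2 h1
    rcases (hw.2 a).2 (by rintro rfl; exact h.disjoint_left a ha (hvw ▸ hv)) with h1 | h1
    · exact h1.symm
    · exact absurd h1 (h.not_adj a ha x hxB)
  · push Not at hZ
    have hY : ∀ y ∈ S, y ∈ side G A B S := by
      refine fun y hy => .inr ⟨hy, fun hyB => ?_⟩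
      obtain ⟨a, ha⟩ := h.nonempty_left
      obtain ⟨w, hwy, hwa⟩ := hG.undominated y a
      rcases h.cover w with hw | hw | hw
      · exact hwy (hZ y hy w hw).symm
      · exact hwy (hyB w hw).symm
      · exact hwa (hZ w hw a ha)
    have harcB : ∀ u ∈ S, ∀ v ∈ S, u ≠ v → ∃ x ∈ B, ∃ y ∈ S, (y = u ∨ y = v) ∧ ¬ G.Adj y x ∧
        ∀ s ∈ S, s ≠ y → G.Adj s x := by
      intro u hu v hv huv
      obtain ⟨x, y, hy, y', hy', hor, hq⟩ := harc u hu v hv huv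
      exact ⟨x, (h.left_or_right_of_quasiDominates hy' hq).resolve_left
        fun hx => hq.not_adj.2 (hZ y hy x hx), y, hy, hor, hq.not_adj.2,
        fun s hs hsy => h.adj_of_quasiDominates hy' hs hq hsy⟩
    obtain ⟨s, hs, -⟩ := hthird h.nonempty_left.some h.nonempty_left.some
    obtain ⟨t, ht, hts, -⟩ := hthird s s
    obtain ⟨x, hx, y, hy, -, hyx, hyS⟩ := harcB s hs t ht hts.symm
    obtain ⟨p, hp, hpy, -⟩ := hthird y y
    obtain ⟨q, hq, hqy, hqp⟩ := hthird y p
    obtain ⟨x', hx', y', hy', hor, hyx', hyS'⟩ := harcB p hp q hq hqp.symm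
    have hyy : y' ≠ y := by rcases hor with rfl | rfl <;> assumption
    have hcharge : ∀ x ∈ B, ∀ y ∈ S, ∀ y' ∈ S, ¬ G.Adj y x → G.Adj y' x →
        ∀ e, f e = (y', x) → (e : Sym2 V) = s(y', y) := by
      intro x hx y hy y' hy' hyx hyx' e he
      have h1 := hf e
      rw [he] at h1
      rcases h1 with h1 | ⟨w, h1, h2⟩
      · exact absurd hyx' h1.1
      · have hyw : y = w := by
          by_contra hne
          rcases (h1.2 y).2 hne with h3 | h3
          · exact h.indep y hy y' hy' h3
          · exact hyx h3
        subst hyw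
        rcases h2 with h2 | h2
        · exact h2.2
        · exact absurd (hY y hy) h2.1
    by_contra! hall
    obtain ⟨e, he⟩ := hall y' (hY y' hy') x (hB x hx)
    obtain ⟨e', he'⟩ := hall y (hY y hy) x' (hB x' hx')
    have h1 := hcharge x hx y hy y' hy' hyx (hyS y' hy' hyy) e he
    have h2 := hcharge x' hx' y' hy' y hy hyx' (hyS' y hy hyy.symm) e' he'
    obtain rfl : e = e' := Subtype.ext (by rw [h1, h2, Sym2.eq_swap])
    rw [he] at he'
    exact hyy (Prod.ext_iff.1 he').1

theorem card_compl_edgeSet_lt [Fintype V] (h : G.IndepSeparation A B S) (hG : G.PairCritical)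
    (hthird : ∀ u v, ∃ t ∈ S, t ≠ u ∧ t ≠ v) :
    Gᶜ.edgeSet.ncard < Fintype.card V ^ 2 / 4 := by
  have main : ∀ {A B : Set V}, G.IndepSeparation A B S →
      (∀ s ∈ S, (∀ b ∈ B, G.Adj s b) → ∀ a ∈ A, G.Adj s a) →
      Gᶜ.edgeSet.ncard < Fintype.card V ^ 2 / 4 := fun {A B} h hno =>
    SimpleGraph.card_compl_edgeSet_lt (side G A B S)
      (fun _ _ hne hadj hside => h.exists_other_side hG hthird hno hne hadj hside)
      (h.exists_uncharged hG hthird hno)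
  by_cases hno : ∀ s ∈ S, (∀ b ∈ B, G.Adj s b) → ∀ a ∈ A, G.Adj s a
  · exact main h hno
  · push Not at hno
    obtain ⟨v, hv, hvB, a, ha, hva⟩ := hno
    refine main h.symm fun u hu huA => ?_
    by_contra huB
    have huv : u ≠ v := by rintro rfl; exact huB hvB
    obtain ⟨t, ht, htu, htv⟩ := hthird u v
    exact h.not_full_on_different_sides hG hu hv ht huv htu htv huA huB hvB
      fun hvA => hva (hvA a ha)

end IndepSeparation

end SimpleGraph

theorem gammaT_le_card {V : Type*} {G : SimpleGraph V} (D : Finset V)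
    (hD : ∀ v, ∃ u ∈ D, G.Adj v u) : gammaT G ≤ D.card :=
  sInf_le ⟨D, rfl, hD⟩

theorem exists_finset_card_eq_gammaT {V : Type*} {G : SimpleGraph V} {n : ℕ}
    (h : gammaT G = n) : ∃ D : Finset V, D.card = n ∧ ∀ v, ∃ u ∈ D, G.Adj v u := by
  have hne : {n : ℕ∞ | ∃ S : Finset V, (S.card : ℕ∞) = n ∧
      ∀ v : V, ∃ u ∈ S, G.Adj v u}.Nonempty := by
    by_contra hemp
    rw [Set.not_nonempty_iff_eq_empty] at hemp
    rw [gammaT, hemp, sInf_empty] at h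
    exact ENat.natCast_ne_top n h.symm
  obtain ⟨D, hc, hD⟩ := csInf_mem hne
  refine ⟨D, ?_, hD⟩
  exact_mod_cast hc.trans h

theorem Critical3.pairCritical {V : Type*} [DecidableEq V] {G : SimpleGraph V}
    (h : Critical3 G) : G.PairCritical := by
  have hund : ∀ p q, ∃ w, ¬ G.Adj w p ∧ ¬ G.Adj w q := by
    intro p q
    by_contra! hc
    have h1 := gammaT_le_card (G := G) {p, q} fun v => by
      by_cases hv : G.Adj v p
      · exact ⟨p, by simp, hv⟩
      · exact ⟨q, by simp, hc v hv⟩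
    rw [h.1] at h1
    have h2 : (({p, q} : Finset V).card : ℕ∞) ≤ 2 := by exact_mod_cast Finset.card_le_two
    exact absurd (h1.trans h2) (by decide)
  refine ⟨hund, fun u v huv hadj => ?_⟩
  have key : ∀ u v x, ¬ G.Adj u v → x ≠ v → x ≠ u →
      (∀ w, (G ⊔ SimpleGraph.fromEdgeSet {s(u, v)}).Adj w u ∨
        (G ⊔ SimpleGraph.fromEdgeSet {s(u, v)}).Adj w x) → G.QuasiDominates u x v := by
    intro u v x hadj hxv hxu hD
    have hD' : ∀ w, w ≠ v → G.Adj w u ∨ G.Adj w x := by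
      intro w hw
      have := hD w
      simp only [SimpleGraph.sup_adj, SimpleGraph.fromEdgeSet_adj, Set.mem_singleton_iff,
        Sym2.eq_iff] at this
      grind
    obtain ⟨w, hwu, hwx⟩ := hund u x
    obtain rfl : w = v := by
      by_contra hne
      rcases hD' w hne with h1 | h1
      · exact hwu h1
      · exact hwx h1
    refine ⟨((hD' x hxv).resolve_right (G.loopless.irrefl x)).symm, fun t => ⟨?_, hD' t⟩⟩
    rintro h1 rfl
    exact h1.elim hwu hwx
  obtain ⟨D, hc, hD⟩ := exists_finset_card_eq_gammaT (n := 2) (h.2 u v huv hadj)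
  obtain ⟨p, q, hpq, rfl⟩ := Finset.card_eq_two.1 hc
  have hD : ∀ w, (G ⊔ SimpleGraph.fromEdgeSet {s(u, v)}).Adj w p ∨
      (G ⊔ SimpleGraph.fromEdgeSet {s(u, v)}).Adj w q := fun w => by simpa using hD w
  have hswap : s(u, v) = s(v, u) := Sym2.eq_swap
  have hadj' : ¬ G.Adj v u := fun h => hadj h.symm
  by_cases hpu : p = u
  · subst hpu
    by_cases hqv : q = v
    · subst hqv
      left
      intro w hw hw'
      simpa [Sym2.eq_iff, hw, hw'] using hD w
    · exact .inr ⟨q, .inl (key p v q hadj hqv hpq.symm hD)⟩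
  by_cases hpv : p = v
  · subst hpv
    by_cases hqu : q = u
    · subst hqu
      left
      intro w hw hw'
      simpa [Sym2.eq_iff, hw, hw', or_comm] using hD w
    · exact .inr ⟨q, .inr (key p u q hadj' hqu hpq.symm (by rwa [hswap] at hD))⟩
  by_cases hqu : q = u
  · subst hqu
    exact .inr ⟨p, .inl (key q v p hadj hpv hpq fun w => (hD w).symm)⟩
  by_cases hqv : q = v
  · subst hqv
    exact .inr ⟨p, .inr (key q u p hadj' hpu hpq fun w => by simpa [hswap] using (hD w).symm)⟩
  obtain ⟨w, hw⟩ := hund p q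
  have := hD w
  simp only [SimpleGraph.sup_adj, SimpleGraph.fromEdgeSet_adj, Set.mem_singleton_iff,
    Sym2.eq_iff] at this
  grind

theorem Set.exists_mem_ne_ne_of_three_le_ncard {V : Type*} {S : Set V} (hS : 3 ≤ S.ncard)
    (u v : V) : ∃ t ∈ S, t ≠ u ∧ t ≠ v := by
  by_contra! hc
  have hsub : S ⊆ {u, v} := fun t ht => by
    by_cases htu : t = u
    · exact .inl htu
    · exact .inr (hc t ht htu)
  have h1 := Set.ncard_le_ncard hsub
  have h2 := Set.ncard_insert_le u {v}
  rw [Set.ncard_singleton] at h2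
  omega

/-- A 3-γₜ-edge-critical graph on n vertices with minimum
degree at least three containing an independent vertex cut of cardinality at
least three has fewer than ⌊n²/4⌋ missing edges. -/
theorem stmt17 {V : Type*} [Fintype V] [DecidableEq V] (G : SimpleGraph V)
    (hcrit : Critical3 G)
    (hdeg : ∀ v : V, 3 ≤ (G.neighborSet v).ncard)
    (S : Set V) (hScard : 3 ≤ S.ncard)
    (hSind : ∀ a ∈ S, ∀ b ∈ S, ¬ G.Adj a b)
    (hScut : RemovalDisconnects G S) :
    Gᶜ.edgeSet.ncard < Fintype.card V ^ 2 / 4 := by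
  obtain ⟨A, B, h⟩ := SimpleGraph.exists_indepSeparation hSind hScut
  exact h.card_compl_edgeSet_lt hcrit.pairCritical (Set.exists_mem_ne_ne_of_three_le_ncard hScard)
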